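/- Let U = [0,1] × [0,1] be the unit square and let Γ be an interior segment barrier for U, i.e., a segment barrier whose union is contained in U. Then the total length of Γ is at least 2 + 10⁻⁵. -/

import Mathlib

open MeasureTheory Set

noncomputable section

/-- A point in the plane. -/
abbrev Pt : Type := EuclideanSpace ℝ (Fin 2)

/-- A line in ℝ² is a set {p + t • v : t ∈ ℝ} for some p, v with v ≠ 0. -/
def IsLine (l : Set Pt) : Prop :=
  ∃ p v : Pt, v ≠ 0 ∧ l = {q : Pt | ∃ t : ℝ, q = p + t • v}

/-- Γ is a barrier (opaque set) for C if every line meeting C also meets Γ. -/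
def IsBarrier (Γ C : Set Pt) : Prop :=
  ∀ l : Set Pt, IsLine l → (l ∩ C).Nonempty → (l ∩ Γ).Nonempty

/-- The closed unit square U = [0,1] × [0,1]. -/
def unitSquare : Set Pt := {p : Pt | p 0 ∈ Icc (0:ℝ) 1 ∧ p 1 ∈ Icc (0:ℝ) 1}

section Helpers

section

/-- Coordinates of a segment barrier of the centred unit square, of length at most `2 + 10⁻⁵`. -/
structure BD (x0 dx y0 dy : ℕ → ℝ) : Prop where
  hx : ∀ i, ∀ u ∈ Icc (0:ℝ) 1, |x0 i + u * dx i| ≤ 1/2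
  hy : ∀ i, ∀ u ∈ Icc (0:ℝ) 1, |y0 i + u * dy i| ≤ 1/2
  cov : ∀ A B t : ℝ, (A ≠ 0 ∨ B ≠ 0) → |t| ≤ (|A| + |B|)/2 →
    ∃ i, ∃ u ∈ Icc (0:ℝ) 1, A * (x0 i + u * dx i) + B * (y0 i + u * dy i) = t
  ne : ∀ i, dx i ≠ 0 ∨ dy i ≠ 0
  sm : Summable fun i => √(dx i ^ 2 + dy i ^ 2)
  le : ∑' i, √(dx i ^ 2 + dy i ^ 2) ≤ 2 + 1/100000

variable {x0 dx y0 dy : ℕ → ℝ}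

theorem BD.swap (h : BD x0 dx y0 dy) : BD y0 dy x0 dx where
  hx := h.hy
  hy := h.hx
  cov := by
    intro A B t hAB ht
    obtain ⟨i, u, hu, e⟩ := h.cov B A t hAB.symm (by linarith)
    exact ⟨i, u, hu, by linarith⟩
  ne := fun i => (h.ne i).symm
  sm := by simpa only [add_comm] using h.sm
  le := by simpa only [add_comm] using h.le

theorem BD.refl (h : BD x0 dx y0 dy) : BD (fun i => - x0 i) (fun i => - dx i) y0 dy where
  hx := by
    intro i u hu
    have := h.hx i u hu
    rw [← abs_neg] at this
    convert this using 2
    ring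
  hy := h.hy
  cov := by
    intro A B t hAB ht
    obtain ⟨i, u, hu, e⟩ := h.cov (-A) B t (by simpa using hAB) (by simpa using ht)
    exact ⟨i, u, hu, by linarith⟩
  ne := fun i => by simpa using h.ne i
  sm := by simpa using h.sm
  le := by simpa using h.le

/-- The width function of the segments. -/
def wd (dx dy : ℕ → ℝ) (A B : ℝ) (i : ℕ) : ℝ := |A * dx i + B * dy i|

theorem wd_nonneg (A B : ℝ) (i : ℕ) : 0 ≤ wd dx dy A B i := abs_nonneg _

theorem wd_le (A B : ℝ) (i : ℕ) : wd dx dy A B i ≤ (|A| + |B|) * √(dx i ^ 2 + dy i ^ 2) := by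
  have h1 : |dx i| ≤ √(dx i ^ 2 + dy i ^ 2) := Real.abs_le_sqrt (by nlinarith [sq_nonneg (dy i)])
  have h2 : |dy i| ≤ √(dx i ^ 2 + dy i ^ 2) := Real.abs_le_sqrt (by nlinarith [sq_nonneg (dx i)])
  calc wd dx dy A B i ≤ |A * dx i| + |B * dy i| := abs_add_le _ _
    _ = |A| * |dx i| + |B| * |dy i| := by rw [abs_mul, abs_mul]
    _ ≤ _ := by nlinarith [abs_nonneg A, abs_nonneg B]

theorem BD.wd_sum (h : BD x0 dx y0 dy) (A B : ℝ) : Summable (wd dx dy A B) :=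
  Summable.of_nonneg_of_le (fun _ => abs_nonneg _) (fun i => wd_le A B i) (h.sm.mul_left _)

/-- waste -/
def om (dx dy : ℕ → ℝ) (A B : ℝ) : ℝ := ∑' i, wd dx dy A B i - (|A| + |B|)

theorem BD.F0 (h : BD x0 dx y0 dy) (A B : ℝ) (hAB : A ≠ 0 ∨ B ≠ 0) (E : Set ℝ)
    (hE : MeasurableSet E) :
    ∑' i, volume (E ∩ uIcc (A * x0 i + B * y0 i) (A * (x0 i + dx i) + B * (y0 i + dy i)))
      + ENNReal.ofReal (|A| + |B|) ≤ volume E + ENNReal.ofReal (∑' i, wd dx dy A B i) := by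
  set I : ℕ → Set ℝ := fun i => uIcc (A * x0 i + B * y0 i) (A * (x0 i + dx i) + B * (y0 i + dy i))
    with hI
  have h1 : Icc (-((|A| + |B|)/2)) ((|A| + |B|)/2) ⊆ E ∪ ⋃ i, (I i \ E) := by
    intro t ht
    obtain ⟨i, u, hu, e⟩ := h.cov A B t hAB (abs_le.2 ht)
    by_cases htE : t ∈ E
    · exact Or.inl htE
    · refine Or.inr (mem_iUnion.2 ⟨i, ?_, htE⟩)
      have : t ∈ segment ℝ (A * x0 i + B * y0 i) (A * (x0 i + dx i) + B * (y0 i + dy i)) := by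
        refine ⟨1 - u, u, by linarith [hu.2], hu.1, by ring, ?_⟩
        simp only [smul_eq_mul]
        rw [← e]; ring
      rwa [segment_eq_uIcc] at this
  have h2 : ENNReal.ofReal (|A| + |B|) ≤ volume E + ∑' i, volume (I i \ E) := by
    calc ENNReal.ofReal (|A| + |B|) = volume (Icc (-((|A| + |B|)/2)) ((|A| + |B|)/2)) := by
          rw [Real.volume_Icc]; congr 1; ring
      _ ≤ volume (E ∪ ⋃ i, (I i \ E)) := measure_mono h1
      _ ≤ volume E + volume (⋃ i, (I i \ E)) := measure_union_le _ _
      _ ≤ _ := by gcongr; exact measure_iUnion_le _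
  have h3 : ∑' i, volume (E ∩ I i) + ∑' i, volume (I i \ E) = ENNReal.ofReal (∑' i, wd dx dy A B i) := by
    rw [← ENNReal.tsum_add, ENNReal.ofReal_tsum_of_nonneg (wd_nonneg A B) (h.wd_sum A B)]
    congr 1; ext i
    rw [inter_comm, measure_inter_add_sdiff _ hE, hI]
    simp only [Real.volume_interval, wd]
    congr 2; ring
  calc _ ≤ ∑' i, volume (E ∩ I i) + (volume E + ∑' i, volume (I i \ E)) := by gcongr
    _ = _ := by rw [← h3]; ring

theorem BD.om_nonneg (h : BD x0 dx y0 dy) (A B : ℝ) (hAB : A ≠ 0 ∨ B ≠ 0) : 0 ≤ om dx dy A B := by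
  have := h.F0 A B hAB ∅ MeasurableSet.empty
  simp only [empty_inter, measure_empty, tsum_zero, zero_add] at this
  have h3 := (ENNReal.ofReal_le_ofReal_iff (tsum_nonneg (wd_nonneg A B))).1 this
  unfold om; linarith

theorem BD.max_sum (h : BD x0 dx y0 dy) {A B : ℝ} :
    HasSum (fun i => max |A * dx i| |B * dy i|)
      ((om dx dy A B + om dx dy A (-B)) / 2 + (|A| + |B|)) := by
  have h1 := ((h.wd_sum A B).hasSum.add (h.wd_sum A (-B)).hasSum).div_const 2
  have e : (fun i => max |A * dx i| |B * dy i|) =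
      fun i => (wd dx dy A B i + wd dx dy A (-B) i) / 2 := by
    ext i
    unfold wd
    rcases abs_cases (A * dx i) with h1 | h1 <;> rcases abs_cases (B * dy i) with h2 | h2 <;>
    rcases abs_cases (A * dx i + B * dy i) with h3 | h3 <;>
    rcases abs_cases (A * dx i + -B * dy i) with h4 | h4 <;>
    rcases max_cases (|A * dx i|) (|B * dy i|) with h5 | h5 <;> linarith
  have e2 : (om dx dy A B + om dx dy A (-B)) / 2 + (|A| + |B|) =
      (∑' i, wd dx dy A B i + ∑' i, wd dx dy A (-B) i) / 2 := by
    unfold om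
    rw [abs_neg]; ring
  rw [e, e2]
  exact h1

theorem fun_ineq {s x y : ℝ} (hs : 0.142 ≤ s) (hs1 : s ≤ 1) (hx : 0 ≤ x) (hy : 0 ≤ y) :
    max x (s * y) + (1 - s)/0.858 * max (0.142 * x) y + (3 - 0.142 * ((1-s)/0.858)) * max x y
      ≤ 4 * √(x^2+y^2) := by
  set L := √(x^2+y^2) with hL
  have hL0 : 0 ≤ L := Real.sqrt_nonneg _
  have hL2 : L^2 = x^2+y^2 := Real.sq_sqrt (by positivity)
  set g := (1 - s)/0.858 with hg
  have hg' : g * 0.858 = 1 - s := by rw [hg]; field_simp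
  have hg0 : 0 ≤ g := by nlinarith
  have hg1 : g ≤ 1 := by nlinarith
  have hLx : x ≤ L := abs_le_of_sq_le_sq' (by nlinarith) hL0 |>.2
  have hLy : y ≤ L := abs_le_of_sq_le_sq' (by nlinarith) hL0 |>.2
  rcases le_total y x with hxy | hxy
  · rw [max_eq_left hxy, max_eq_left (by nlinarith : s * y ≤ x)]
    rcases le_total y (0.142*x) with h2 | h2
    · rw [max_eq_left h2]; nlinarith
    · rw [max_eq_right h2]
      have : (1 - 0.142/4) * x + y/4 ≤ L := abs_le_of_sq_le_sq' (by nlinarith [sq_nonneg (x * 0.25 - y * (1-0.142/4))]) hL0 |>.2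
      nlinarith
  · rw [max_eq_right hxy, max_eq_right (by nlinarith : 0.142 * x ≤ y)]
    have : (4 - 0.142) * y + x ≤ 4 * L := abs_le_of_sq_le_sq' (by nlinarith [sq_nonneg (x * (4-0.142) - y )]) (by linarith) |>.2
    rcases max_cases x (s*y) with h | h <;> rw [h.1] <;> nlinarith

theorem min_ineq {x y : ℝ} (hx : 0 ≤ x) (hy : 0 ≤ y) :
    x + y + 333 * max x y ≤ 334.0015 * √(x^2+y^2) := by
  wlog hxy : y ≤ x with H
  · have := H hy hx (by linarith)
    rw [max_comm, add_comm (y^2)] at this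
    linarith
  set L := √(x^2+y^2) with hL
  have hL0 : 0 ≤ L := Real.sqrt_nonneg _
  have hL2 : L^2 = x^2+y^2 := Real.sq_sqrt (by positivity)
  have hLx : x ≤ L := abs_le_of_sq_le_sq' (by nlinarith) hL0 |>.2
  rw [max_eq_left hxy]
  have : y ≤ 0.0015 * L + 334 * (L - x) := by
    refine abs_le_of_sq_le_sq' ?_ (by nlinarith) |>.2
    nlinarith [mul_nonneg hL0 (sub_nonneg.2 hLx), sq_nonneg (0.0015 * L - 334 * (L-x))]
  linarith

theorem notH_ineq {x y : ℝ} (hx : 0 ≤ x) (hy : 0 ≤ y) (h : x < 30 * y) :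
    x + 2200 * max x y ≤ 2200.0015 * √(x^2+y^2) := by
  set L := √(x^2+y^2) with hL
  have hL0 : 0 ≤ L := Real.sqrt_nonneg _
  have hL2 : L^2 = x^2+y^2 := Real.sq_sqrt (by positivity)
  have hLx : x ≤ L := abs_le_of_sq_le_sq' (by nlinarith) hL0 |>.2
  have hLy : y ≤ L := abs_le_of_sq_le_sq' (by nlinarith) hL0 |>.2
  rcases le_total x y with hxy | hxy
  · have := min_ineq hx hy
    rw [max_eq_right hxy] at *
    linarith
  · rw [max_eq_left hxy]
    have : 2201/2200 * x ≤ L := abs_le_of_sq_le_sq' (by nlinarith) hL0 |>.2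
    linarith

theorem BD.om_le (h : BD x0 dx y0 dy) {s : ℝ} (hs : 0.142 ≤ s) (hs1 : s ≤ 1) :
    om dx dy 1 s + om dx dy 1 (-s) ≤ 8 / 100000 := by
  have h1 := h.max_sum (A := 1) (B := s)
  have h2 := h.max_sum (A := 1) (B := 1)
  have h3 := h.max_sum (A := 0.142) (B := 1)
  have n1 := h.om_nonneg 1 1 (by norm_num)
  have n2 := h.om_nonneg 1 (-1) (by norm_num)
  have n3 := h.om_nonneg 0.142 1 (by norm_num)
  have n4 := h.om_nonneg 0.142 (-1) (by norm_num)
  have hl := h.sm.hasSum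
  have key := hasSum_le (fun i => ?_) ((h1.add (h3.mul_left ((1-s)/0.858))).add
    (h2.mul_left (3 - 0.142 * ((1-s)/0.858)))) (hl.mul_left 4)
  · have hle := h.le
    have e : |s| = s := abs_of_nonneg (by linarith)
    have e2 : |(0.142:ℝ)| = 0.142 := abs_of_nonneg (by norm_num)
    rw [e, e2, abs_one] at key
    set g := (1 - s)/0.858 with hg
    have hg' : g * 0.858 = 1 - s := by rw [hg]; field_simp
    have hg0 : 0 ≤ g := by nlinarith
    have hg1 : g ≤ 1 := by nlinarith
    have q1 := mul_nonneg hg0 (add_nonneg n3 n4)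
    have q2 := mul_nonneg (by linarith : 0 ≤ 3 - 0.142 * g) (add_nonneg n1 n2)
    nlinarith
  · have := fun_ineq hs hs1 (abs_nonneg (dx i)) (abs_nonneg (dy i))
    simp only [sq_abs] at this
    simp only [abs_mul, one_mul, abs_of_nonneg (by linarith : 0 ≤ s),
      abs_of_nonneg (by norm_num : (0:ℝ) ≤ 0.142)]
    exact this

theorem BD.proj_le (h : BD x0 dx y0 dy) : om dx dy 1 0 ≤ 0.0065 := by
  have h1 := h.wd_sum 1 0 |>.hasSum
  have h2 := h.wd_sum 0 1 |>.hasSum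
  have h3 := h.max_sum (A := 1) (B := 1)
  have n1 := h.om_nonneg 1 1 (by norm_num)
  have n2 := h.om_nonneg 1 (-1) (by norm_num)
  have n3 := h.om_nonneg 0 1 (by norm_num)
  have key := hasSum_le (fun i => ?_) ((h1.add h2).add (h3.mul_left 333)) (h.sm.hasSum.mul_left 334.0015)
  · have hle := h.le
    unfold om at n3 ⊢
    simp only [abs_one, abs_zero] at *
    linarith
  · have := min_ineq (abs_nonneg (dx i)) (abs_nonneg (dy i))
    simp only [sq_abs] at this
    simpa [wd] using this

/-- weights of the almost horizontal segments -/
def wH (dx dy : ℕ → ℝ) (i : ℕ) : ℝ := if 30 * |dy i| ≤ |dx i| then |dx i| else 0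

theorem wH_nonneg (i : ℕ) : 0 ≤ wH dx dy i := by
  unfold wH; split_ifs <;> positivity

theorem wH_le (i : ℕ) : wH dx dy i ≤ wd dx dy 1 0 i := by
  unfold wH wd; split_ifs <;> simp

theorem BD.wH_sum (h : BD x0 dx y0 dy) : Summable (wH dx dy) :=
  Summable.of_nonneg_of_le wH_nonneg wH_le (h.wd_sum 1 0)

theorem BD.wH_ge (h : BD x0 dx y0 dy) : 0.9749 ≤ ∑' i, wH dx dy i := by
  have h1 := h.wd_sum 1 0 |>.hasSum
  have h2 := h.wH_sum.hasSum
  have h3 := h.max_sum (A := 1) (B := 1)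
  have n1 := h.om_nonneg 1 1 (by norm_num)
  have n2 := h.om_nonneg 1 (-1) (by norm_num)
  have n3 := h.om_nonneg 1 0 (by norm_num)
  have key := hasSum_le (fun i => ?_) (h1.add (h3.mul_left 2200)) ((h.sm.hasSum.mul_left 2200.0015).add h2)
  · have hle := h.le
    unfold om at n3
    simp only [abs_one, abs_zero] at *
    linarith
  · have := notH_ineq (abs_nonneg (dx i)) (abs_nonneg (dy i))
    simp only [sq_abs] at this
    have m1 : |dx i| ≤ √(dx i ^ 2 + dy i ^ 2) := Real.abs_le_sqrt (by nlinarith [sq_nonneg (dy i)])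
    have m2 : |dy i| ≤ √(dx i ^ 2 + dy i ^ 2) := Real.abs_le_sqrt (by nlinarith [sq_nonneg (dx i)])
    unfold wH wd
    simp only [one_mul, zero_mul, add_zero]
    split_ifs with hh
    · rcases max_cases |dx i| |dy i| with h5 | h5 <;> rw [h5.1] <;> nlinarith [Real.sqrt_nonneg (dx i ^ 2 + dy i ^ 2)]
    · linarith [this (by linarith)]

end

section

variable {x0 dx y0 dy : ℕ → ℝ}

/-- weighted length measure on the parameter space of all segments -/
def Mw (c : ℕ → ℝ) : Measure (ℕ × ℝ) :=
  Measure.sum fun i => ENNReal.ofReal (c i) • (volume.restrict (Ioo (0:ℝ) 1)).map (fun u => (i, u))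

instance (c : ℕ → ℝ) : SFinite (Mw c) := by unfold Mw; infer_instance

theorem meas_mk (i : ℕ) : Measurable (fun u : ℝ => (i, u)) := by fun_prop

theorem Mw_apply (c : ℕ → ℝ) {E : Set (ℕ × ℝ)} (hE : MeasurableSet E) :
    Mw c E = ∑' i, ENNReal.ofReal (c i) * volume ({u | (i, u) ∈ E} ∩ Ioo (0:ℝ) 1) := by
  unfold Mw
  rw [Measure.sum_apply _ hE]
  congr 1; ext i
  rw [Measure.smul_apply, Measure.map_apply (meas_mk i) hE, Measure.restrict_apply (meas_mk i hE)]
  rfl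

theorem Mw_mono_set (c : ℕ → ℝ) {E F : Set (ℕ × ℝ)} (hE : MeasurableSet E) (hF : MeasurableSet F)
    (h : ∀ i, ∀ u ∈ Ioo (0:ℝ) 1, (i, u) ∈ E → (i, u) ∈ F) : Mw c E ≤ Mw c F := by
  rw [Mw_apply c hE, Mw_apply c hF]
  refine ENNReal.tsum_le_tsum fun i => ?_
  refine mul_le_mul' le_rfl (measure_mono ?_)
  rintro u ⟨h1, h2⟩
  exact ⟨h i u h2 h1, h2⟩

theorem Mw_le (c d : ℕ → ℝ) {K : ℝ} (hK : 0 ≤ K) (h : ∀ i, c i ≤ K * d i) :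
    Mw c ≤ ENNReal.ofReal K • Mw d := by
  refine Measure.le_iff.2 fun E hE => ?_
  rw [Measure.smul_apply, Mw_apply c hE, Mw_apply d hE, smul_eq_mul, ← ENNReal.tsum_mul_left]
  refine ENNReal.tsum_le_tsum fun i => ?_
  rw [← mul_assoc, ← ENNReal.ofReal_mul hK]
  gcongr
  exact h i

theorem Mw_univ {c : ℕ → ℝ} (h0 : ∀ i, 0 ≤ c i) (hc : Summable c) :
    Mw c univ = ENNReal.ofReal (∑' i, c i) := by
  rw [Mw_apply c MeasurableSet.univ, ENNReal.ofReal_tsum_of_nonneg h0 hc]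
  simp

/-- position of a point in a projection -/
def TT (x0 dx y0 dy : ℕ → ℝ) (A B : ℝ) (p : ℕ × ℝ) : ℝ :=
  A * (x0 p.1 + p.2 * dx p.1) + B * (y0 p.1 + p.2 * dy p.1)

theorem meas_nat (f : ℕ → ℝ) : Measurable f := measurable_from_top

theorem TT_meas' : Measurable (fun z : ℝ × (ℕ × ℝ) => TT x0 dx y0 dy 1 z.1 z.2) := by
  have h1 := meas_nat x0
  have h2 := meas_nat dx
  have h3 := meas_nat y0
  have h4 := meas_nat dy
  unfold TT
  fun_prop

theorem TT_meas (A B : ℝ) : Measurable (TT x0 dx y0 dy A B) := by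
  have h1 := meas_nat x0
  have h2 := meas_nat dx
  have h3 := meas_nat y0
  have h4 := meas_nat dy
  unfold TT
  fun_prop

theorem aff_vol (a d : ℝ) (E : Set ℝ) :
    ENNReal.ofReal |d| * volume ({u | a + u * d ∈ E} ∩ Ioo (0:ℝ) 1) ≤ volume (E ∩ uIcc a (a + d)) := by
  by_cases hd : d = 0
  · simp [hd]
  have h1 : {u | a + u * d ∈ E} ∩ Ioo (0:ℝ) 1 ⊆ (· * d) ⁻¹' ((fun x => a + x) ⁻¹' (E ∩ uIcc a (a + d))) := by
    rintro u ⟨h1, h2⟩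
    refine ⟨h1, ?_⟩
    rw [← segment_eq_uIcc]
    refine ⟨1 - u, u, by linarith [h2.2], h2.1.le, by ring, ?_⟩
    simp only [smul_eq_mul]; ring
  calc _ ≤ ENNReal.ofReal |d| * volume ((· * d) ⁻¹' ((fun x => a + x) ⁻¹' (E ∩ uIcc a (a + d)))) := by
        gcongr
    _ = _ := by
        rw [Real.volume_preimage_mul_right hd, measure_preimage_add, ← mul_assoc,
          ← ENNReal.ofReal_mul (abs_nonneg _), abs_inv, mul_inv_cancel₀ (abs_ne_zero.2 hd)]
        simp

theorem BD.F1 (h : BD x0 dx y0 dy) (A B : ℝ) (hAB : A ≠ 0 ∨ B ≠ 0) {c : ℕ → ℝ}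
    (hc : ∀ i, c i ≤ wd dx dy A B i) {E : Set ℝ} (hE : MeasurableSet E) :
    Mw c (TT x0 dx y0 dy A B ⁻¹' E) ≤ volume E + ENNReal.ofReal (om dx dy A B) := by
  have h0 := h.F0 A B hAB E hE
  have h1 : Mw c (TT x0 dx y0 dy A B ⁻¹' E) ≤ ∑' i, volume (E ∩ uIcc (A * x0 i + B * y0 i)
      (A * (x0 i + dx i) + B * (y0 i + dy i))) := by
    rw [Mw_apply c (TT_meas A B hE)]
    refine ENNReal.tsum_le_tsum fun i => ?_
    have := aff_vol (A * x0 i + B * y0 i) (A * dx i + B * dy i) E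
    have e1 : A * x0 i + B * y0 i + (A * dx i + B * dy i) =
      A * (x0 i + dx i) + B * (y0 i + dy i) := by ring
    have e2 : {u | A * x0 i + B * y0 i + u * (A * dx i + B * dy i) ∈ E} =
      {u | (i, u) ∈ TT x0 dx y0 dy A B ⁻¹' E} := by
      ext u
      simp only [mem_setOf_eq, mem_preimage, TT]
      rw [show A * x0 i + B * y0 i + u * (A * dx i + B * dy i) =
        A * (x0 i + u * dx i) + B * (y0 i + u * dy i) by ring]
    rw [e1, e2] at this
    refine le_trans ?_ this
    gcongr
    exact hc i
  have e : ENNReal.ofReal (∑' i, wd dx dy A B i) =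
      ENNReal.ofReal (om dx dy A B) + ENNReal.ofReal (|A| + |B|) := by
    rw [← ENNReal.ofReal_add (h.om_nonneg A B hAB) (by positivity)]
    unfold om; congr 1; ring
  rw [e, ← add_assoc] at h0
  exact h1.trans ((ENNReal.add_le_add_iff_right ENNReal.ofReal_ne_top).1 h0)

/-- widths of the nice segments -/
def cN (dx dy : ℕ → ℝ) (N : Set ℕ) (s : ℝ) : ℕ → ℝ := N.indicator (wd dx dy 1 s)

theorem cN_le (N : Set ℕ) (s : ℝ) (i : ℕ) : cN dx dy N s i ≤ wd dx dy 1 s i :=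
  indicator_le_self' (fun _ _ => wd_nonneg _ _ _) i

/-- projected measure -/
def nu (x0 dx y0 dy : ℕ → ℝ) (N : Set ℕ) (s : ℝ) : Measure ℝ :=
  (Mw (cN dx dy N s)).map (TT x0 dx y0 dy 1 s)

theorem BD.nu_le (h : BD x0 dx y0 dy) (N : Set ℕ) (s : ℝ) {E : Set ℝ} (hE : MeasurableSet E) :
    nu x0 dx y0 dy N s E ≤ volume E + ENNReal.ofReal (om dx dy 1 s) := by
  unfold nu
  rw [Measure.map_apply (TT_meas 1 s) hE]
  exact h.F1 1 s (by norm_num) (cN_le N s) hE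

/-- the clusters -/
def Gs (x0 dx y0 dy : ℕ → ℝ) (N : Set ℕ) : Set (ℝ × ℝ × ℝ) :=
  {g | g.1 ∈ Icc (0.142:ℝ) 1 ∧ 0 < g.2.2 ∧
    ENNReal.ofReal (4 * g.2.2) ≤ nu x0 dx y0 dy N g.1 (Metric.closedBall g.2.1 g.2.2)}

/-- tent function of a cluster -/
def vv (s t : ℝ) (g : ℝ × ℝ × ℝ) : ℝ := g.2.2 - |t - g.2.1| - 2 * |s - g.1|

/-- scale function -/
def rr (x0 dx y0 dy : ℕ → ℝ) (N : Set ℕ) (s t : ℝ) : ℝ :=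
  sSup (insert 0 (vv s t '' Gs x0 dx y0 dy N))

/-- hypotheses used in the core argument -/
structure Hyp (x0 dx y0 dy : ℕ → ℝ) (N : Set ℕ) : Prop extends BD x0 dx y0 dy where
  hom : ∀ s ∈ Icc (0.142:ℝ) 1, om dx dy 1 s ≤ 1/10000
  hN : ∀ i ∈ N, ∀ s ∈ Icc (0.142:ℝ) 1, |dy i| ≤ 10 * wd dx dy 1 s i

variable {N : Set ℕ}

theorem Hyp.R_le (h : Hyp x0 dx y0 dy N) {g : ℝ × ℝ × ℝ} (hg : g ∈ Gs x0 dx y0 dy N) :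
    g.2.2 ≤ 1/20000 := by
  obtain ⟨h1, h2, h3⟩ := hg
  have := h3.trans (h.nu_le N g.1 Metric.isClosed_closedBall.measurableSet)
  rw [Real.volume_closedBall, ← ENNReal.ofReal_add (by linarith) (h.om_nonneg _ _ (by norm_num))] at this
  have := (ENNReal.ofReal_le_ofReal_iff (add_nonneg (by linarith) (h.om_nonneg _ _ (by norm_num)))).1 this
  linarith [h.hom _ h1]

theorem Hyp.bdd (h : Hyp x0 dx y0 dy N) (s t : ℝ) :
    ∀ b ∈ (insert 0 (vv s t '' Gs x0 dx y0 dy N)), b ≤ 1/20000 := by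
  rintro b (rfl | ⟨g, hg, rfl⟩)
  · norm_num
  · have := h.R_le hg
    unfold vv
    linarith [abs_nonneg (t - g.2.1), abs_nonneg (s - g.1)]

theorem Hyp.rr_le (h : Hyp x0 dx y0 dy N) (s t : ℝ) : rr x0 dx y0 dy N s t ≤ 1/20000 :=
  csSup_le (insert_nonempty _ _) (h.bdd s t)

theorem Hyp.rr_nonneg (h : Hyp x0 dx y0 dy N) (s t : ℝ) : 0 ≤ rr x0 dx y0 dy N s t :=
  le_csSup ⟨_, h.bdd s t⟩ (mem_insert _ _)

theorem Hyp.le_rr (h : Hyp x0 dx y0 dy N) (s t : ℝ) {g} (hg : g ∈ Gs x0 dx y0 dy N) :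
    vv s t g ≤ rr x0 dx y0 dy N s t :=
  le_csSup ⟨_, h.bdd s t⟩ (mem_insert_of_mem _ ⟨g, hg, rfl⟩)

theorem Hyp.lip (h : Hyp x0 dx y0 dy N) (s t s' t' : ℝ) :
    rr x0 dx y0 dy N s t ≤ rr x0 dx y0 dy N s' t' + |t - t'| + 2 * |s - s'| := by
  refine csSup_le (insert_nonempty _ _) ?_
  rintro b (rfl | ⟨g, hg, rfl⟩)
  · have := h.rr_nonneg s' t'
    positivity
  · have := h.le_rr s' t' hg
    unfold vv at *
    linarith [abs_sub_le t' t g.2.1, abs_sub_le s' s g.1, abs_sub_comm t' t, abs_sub_comm s' s]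

theorem Hyp.cont (h : Hyp x0 dx y0 dy N) :
    Continuous (fun z : ℝ × ℝ => rr x0 dx y0 dy N z.1 z.2) := by
  have : LipschitzWith 3 (fun z : ℝ × ℝ => rr x0 dx y0 dy N z.1 z.2) := by
    refine LipschitzWith.of_le_add_mul 3 fun z z' => ?_
    have := h.lip z.1 z.2 z'.1 z'.2
    rw [Prod.dist_eq, Real.dist_eq, Real.dist_eq]
    push_cast
    linarith [le_max_left |z.1 - z'.1| |z.2 - z'.2|, le_max_right |z.1 - z'.1| |z.2 - z'.2|]
  exact this.continuous

theorem Hyp.max_rr (h : Hyp x0 dx y0 dy N) {s : ℝ} (hs : s ∈ Icc (0.142:ℝ) 1) (t : ℝ) :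
    nu x0 dx y0 dy N s (Metric.closedBall t (rr x0 dx y0 dy N s t)) ≤
      ENNReal.ofReal (4 * rr x0 dx y0 dy N s t) := by
  set r := rr x0 dx y0 dy N s t with hr
  have h0 : 0 ≤ r := h.rr_nonneg s t
  have key : ∀ ε > 0, nu x0 dx y0 dy N s (Metric.closedBall t r) ≤ ENNReal.ofReal (4 * r) + ENNReal.ofReal (4 * ε) := by
    intro ε hε
    by_contra hcon
    push Not at hcon
    rw [← ENNReal.ofReal_add (by linarith) (by linarith)] at hcon
    have hg : (s, t, r + ε) ∈ Gs x0 dx y0 dy N := by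
      refine ⟨hs, by simp; linarith, ?_⟩
      simp only
      rw [mul_add]
      exact hcon.le.trans (measure_mono (Metric.closedBall_subset_closedBall (by linarith)))
    have := h.le_rr s t hg
    simp only [vv, sub_self, abs_zero] at this
    linarith
  refine ENNReal.le_of_forall_pos_le_add fun ε hε _ => ?_
  refine (key (ε/4) (by positivity)).trans (le_of_eq ?_)
  rw [mul_div_cancel₀ _ (by norm_num)]
  simp

theorem Hyp.ex (h : Hyp x0 dx y0 dy N) {s t : ℝ} (hr : 0 < rr x0 dx y0 dy N s t) :
    ∃ g ∈ Gs x0 dx y0 dy N, 0 < vv s t g := by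
  obtain ⟨b, hb, hb0⟩ := exists_lt_of_lt_csSup (insert_nonempty _ _) hr
  rcases hb with rfl | ⟨g, hg, rfl⟩
  · exact absurd hb0 (lt_irrefl _)
  · exact ⟨g, hg, hb0⟩

theorem Hyp.prop (h : Hyp x0 dx y0 dy N) {s : ℝ} (hs : s ∈ Icc (0.142:ℝ) 1) {g : ℝ × ℝ × ℝ}
    (hg : g ∈ Gs x0 dx y0 dy N) (hgs : 2 * |s - g.1| < g.2.2) :
    ENNReal.ofReal (1.59 * (2 * (g.2.2 + |s - g.1| / 2))) ≤
      nu x0 dx y0 dy N s (Metric.closedBall g.2.1 (g.2.2 + |s - g.1| / 2)) := by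
  have hR := h.R_le hg
  obtain ⟨h1, h2, h3⟩ := hg
  set τ := |s - g.1| with hτ
  have hτ0 : 0 ≤ τ := abs_nonneg _
  have hm : MeasurableSet (Metric.closedBall g.2.1 g.2.2) := Metric.isClosed_closedBall.measurableSet
  have hm' : MeasurableSet (Metric.closedBall g.2.1 (g.2.2 + τ/2)) := Metric.isClosed_closedBall.measurableSet
  have k1 : Mw (cN dx dy N g.1) ≤ ENNReal.ofReal 1.001 • Mw (cN dx dy N s) := by
    refine Mw_le _ _ (by norm_num) fun i => ?_
    unfold cN
    by_cases hi : i ∈ N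
    · rw [indicator_of_mem hi, indicator_of_mem hi]
      have a1 := h.hN i hi s hs
      have a2 : wd dx dy 1 g.1 i ≤ wd dx dy 1 s i + τ * |dy i| := by
        unfold wd
        rw [hτ, abs_sub_comm, ← abs_mul]
        refine le_trans (le_of_eq ?_) (abs_add_le _ _)
        congr 1; ring
      have a3 := wd_nonneg (dx := dx) (dy := dy) 1 s i
      nlinarith [abs_nonneg (dy i)]
    · rw [indicator_of_notMem hi, indicator_of_notMem hi]; simp
  have k2 : ENNReal.ofReal (4 * g.2.2) ≤ ENNReal.ofReal 1.001 *
      nu x0 dx y0 dy N s (Metric.closedBall g.2.1 (g.2.2 + τ / 2)) := by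
    refine h3.trans ?_
    unfold nu
    rw [Measure.map_apply (TT_meas _ _) hm, Measure.map_apply (TT_meas _ _) hm']
    refine (k1 _).trans ?_
    rw [Measure.smul_apply, smul_eq_mul]
    refine mul_le_mul' le_rfl (Mw_mono_set _ (TT_meas _ _ hm) (TT_meas _ _ hm') fun i u hu hin => ?_)
    simp only [mem_preimage, Metric.mem_closedBall, Real.dist_eq, TT] at hin ⊢
    have hy := h.hy i u ⟨hu.1.le, hu.2.le⟩
    have e : 1 * (x0 i + u * dx i) + s * (y0 i + u * dy i) - g.2.1 =
      (1 * (x0 i + u * dx i) + g.1 * (y0 i + u * dy i) - g.2.1) + (s - g.1) * (y0 i + u * dy i) := by ring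
    rw [e]
    refine (abs_add_le _ _).trans ?_
    rw [abs_mul]
    nlinarith
  have e : (4 * g.2.2) = 1.001 * (4 * g.2.2 / 1.001) := by field_simp
  rw [e, ENNReal.ofReal_mul (by norm_num)] at k2
  have := (ENNReal.mul_le_mul_iff_right (by simp; norm_num) ENNReal.ofReal_ne_top).1 k2
  refine le_trans (ENNReal.ofReal_le_ofReal ?_) this
  rw [le_div_iff₀ (by norm_num)]
  linarith

theorem Hyp.vitali (h : Hyp x0 dx y0 dy N) {s : ℝ} (hs : s ∈ Icc (0.142:ℝ) 1) :
    nu x0 dx y0 dy N s {t | 0 < rr x0 dx y0 dy N s t} ≤ ENNReal.ofReal (7.8 * om dx dy 1 s) := by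
  have hom0 := h.om_nonneg 1 s (by norm_num)
  set ι : Set (ℝ × ℝ × ℝ) := {g | g ∈ Gs x0 dx y0 dy N ∧ 2 * |s - g.1| < g.2.2} with hι
  set ρ : ℝ × ℝ × ℝ → ℝ := fun g => g.2.2 + |s - g.1| / 2 with hρ
  have ρpos : ∀ g ∈ ι, 0 < ρ g := fun g hg => by
    have := hg.1.2.1
    have := abs_nonneg (s - g.1)
    simp only [hρ]; linarith
  obtain ⟨u, hu, hdisj, hcov⟩ := Vitali.exists_disjoint_subfamily_covering_enlargement_closedBall
    ι (fun g => g.2.1) ρ 1 (fun g hg => by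
      have := h.R_le hg.1
      have := hg.2
      simp only [hρ]; linarith) 4 (by norm_num)
  have hcount : u.Countable := by
    refine hdisj.countable_of_nonempty_interior fun g hg => ?_
    refine ⟨g.2.1, Metric.ball_subset_interior_closedBall (Metric.mem_ball_self (ρpos g (hu hg)))⟩
  set U : Set ℝ := ⋃ g ∈ u, Metric.closedBall g.2.1 (ρ g) with hU
  have mU : MeasurableSet U := MeasurableSet.biUnion hcount fun g _ => Metric.isClosed_closedBall.measurableSet
  have volU : volume U = ∑' g : u, ENNReal.ofReal (2 * ρ g) := by
    rw [hU, measure_biUnion hcount hdisj fun g _ => Metric.isClosed_closedBall.measurableSet]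
    simp only [Real.volume_closedBall]
  have nuU : ENNReal.ofReal 1.59 * volume U ≤ nu x0 dx y0 dy N s U := by
    rw [volU, hU, measure_biUnion hcount hdisj fun g _ => Metric.isClosed_closedBall.measurableSet,
      ← ENNReal.tsum_mul_left]
    refine ENNReal.tsum_le_tsum fun g => ?_
    rw [← ENNReal.ofReal_mul (by norm_num)]
    exact h.prop hs (hu g.2).1 (hu g.2).2
  have hE : {t | 0 < rr x0 dx y0 dy N s t} ⊆ ⋃ g ∈ u, Metric.closedBall g.2.1 (4 * ρ g) := by
    intro t ht
    obtain ⟨g, hg, hv⟩ := h.ex ht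
    unfold vv at hv
    have hgι : g ∈ ι := ⟨hg, by linarith [abs_nonneg (t - g.2.1)]⟩
    obtain ⟨b, hb, hsub⟩ := hcov g hgι
    refine mem_biUnion hb (hsub ?_)
    simp only [Metric.mem_closedBall, Real.dist_eq, hρ]
    linarith [abs_nonneg (s - g.1)]
  have hvE : volume {t | 0 < rr x0 dx y0 dy N s t} ≤ 4 * volume U := by
    calc _ ≤ volume (⋃ g ∈ u, Metric.closedBall g.2.1 (4 * ρ g)) := measure_mono hE
      _ ≤ ∑' g : u, volume (Metric.closedBall g.1.2.1 (4 * ρ g)) := measure_biUnion_le _ hcount _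
      _ = 4 * volume U := by
        rw [volU, ← ENNReal.tsum_mul_left]
        congr 1; ext g
        rw [Real.volume_closedBall, show 2 * (4 * ρ g) = 4 * (2 * ρ g) by ring,
          ENNReal.ofReal_mul (by norm_num)]
        simp
  have hfin : volume U ≠ ⊤ := by
    have h1 : nu x0 dx y0 dy N s U ≤ Mw (cN dx dy N s) univ := by
      unfold nu
      rw [Measure.map_apply (TT_meas _ _) mU]
      exact measure_mono (subset_univ _)
    have h2 : Mw (cN dx dy N s) univ ≠ ⊤ := by
      rw [Mw_univ]
      · exact ENNReal.ofReal_ne_top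
      · exact fun i => indicator_nonneg (fun _ _ => wd_nonneg _ _ _) i
      · exact (h.wd_sum 1 s).indicator N
    intro htop
    rw [htop, ENNReal.mul_top (by simp; norm_num)] at nuU
    exact h2 (top_le_iff.1 (nuU.trans h1))
  have hr : 0.59 * (volume U).toReal ≤ om dx dy 1 s := by
    have := nuU.trans (h.nu_le N s mU)
    rw [← ENNReal.ofReal_toReal hfin, ← ENNReal.ofReal_mul (by norm_num),
      ← ENNReal.ofReal_add ENNReal.toReal_nonneg hom0] at this
    have := (ENNReal.ofReal_le_ofReal_iff (add_nonneg ENNReal.toReal_nonneg hom0)).1 this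
    linarith
  have mE : MeasurableSet {t | 0 < rr x0 dx y0 dy N s t} := by
    have : Continuous fun t => rr x0 dx y0 dy N s t := h.cont.comp (by fun_prop : Continuous fun t : ℝ => (s, t))
    exact (isOpen_lt continuous_const this).measurableSet
  calc _ ≤ _ := h.nu_le N s mE
    _ ≤ 4 * volume U + ENNReal.ofReal (om dx dy 1 s) := by gcongr
    _ = ENNReal.ofReal (4 * (volume U).toReal + om dx dy 1 s) := by
      rw [ENNReal.ofReal_add (by positivity) hom0, ENNReal.ofReal_mul (by norm_num), ENNReal.ofReal_toReal hfin]
      simp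
    _ ≤ _ := ENNReal.ofReal_le_ofReal (by linarith)

end

section

variable {x0 dx y0 dy : ℕ → ℝ} {N : Set ℕ}

theorem single_vol (i : ℕ) (s t u R : ℝ) (hu : TT x0 dx y0 dy 1 s (i, u) = t) (hw : 0 < wd dx dy 1 s i)
    (hR0 : 0 < R) (h1 : R < u * wd dx dy 1 s i) (h2 : R < (1 - u) * wd dx dy 1 s i) :
    ENNReal.ofReal (2 * R) ≤ ENNReal.ofReal (wd dx dy 1 s i) *
      volume ({u' | (i, u') ∈ TT x0 dx y0 dy 1 s ⁻¹' (Metric.closedBall t R)} ∩ Ioo (0:ℝ) 1) := by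
  set w := wd dx dy 1 s i with hwdef
  have hsub : Metric.closedBall u (R / w) ⊆
      {u' | (i, u') ∈ TT x0 dx y0 dy 1 s ⁻¹' (Metric.closedBall t R)} ∩ Ioo (0:ℝ) 1 := by
    intro u' hu'
    rw [Metric.mem_closedBall, Real.dist_eq, le_div_iff₀ hw] at hu'
    have b1 : |u' - u| < u := by
      by_contra hc; push Not at hc; nlinarith
    have b2 : |u' - u| < 1 - u := by
      by_contra hc; push Not at hc; nlinarith
    refine ⟨?_, by linarith [(abs_lt.1 b1).1], by linarith [(abs_lt.1 b2).2]⟩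
    change TT x0 dx y0 dy 1 s (i, u') ∈ Metric.closedBall t R
    rw [Metric.mem_closedBall, Real.dist_eq, ← hu]
    have e : TT x0 dx y0 dy 1 s (i, u') - TT x0 dx y0 dy 1 s (i, u) =
        (u' - u) * (1 * dx i + s * dy i) := by
      simp only [TT]; ring
    rw [e, abs_mul]
    exact hu'
  calc _ = ENNReal.ofReal w * volume (Metric.closedBall u (R / w)) := by
        rw [Real.volume_closedBall, ← ENNReal.ofReal_mul hw.le]
        congr 1; field_simp
    _ ≤ _ := mul_le_mul' le_rfl (measure_mono hsub)

theorem Hyp.pos (h : Hyp x0 dx y0 dy N) {s : ℝ} (hs : s ∈ Icc (0.142:ℝ) 1) {p q : ℕ × ℝ}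
    (hp : p.2 ∈ Ioo (0:ℝ) 1) (hq : q.2 ∈ Ioo (0:ℝ) 1) (hne : p.1 ≠ q.1)
    (hp0 : 0 < cN dx dy N s p.1) (hq0 : 0 < cN dx dy N s q.1)
    (he : TT x0 dx y0 dy 1 s p = TT x0 dx y0 dy 1 s q) :
    0 < rr x0 dx y0 dy N s (TT x0 dx y0 dy 1 s p) := by
  obtain ⟨i, u⟩ := p
  obtain ⟨j, v⟩ := q
  simp only at hp hq hne hp0 hq0
  have wi : cN dx dy N s i = wd dx dy 1 s i := by
    unfold cN at *
    by_cases hi : i ∈ N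
    · rw [indicator_of_mem hi]
    · rw [indicator_of_notMem hi] at hp0; exact absurd hp0 (lt_irrefl _)
  have wj : cN dx dy N s j = wd dx dy 1 s j := by
    unfold cN at *
    by_cases hi : j ∈ N
    · rw [indicator_of_mem hi]
    · rw [indicator_of_notMem hi] at hq0; exact absurd hq0 (lt_irrefl _)
  have hp0' := hp0
  have hq0' := hq0
  rw [wi] at hp0'
  rw [wj] at hq0'
  set t := TT x0 dx y0 dy 1 s (i, u) with ht
  have a1 : 0 < u * wd dx dy 1 s i := mul_pos hp.1 hp0'
  have a2 : 0 < (1 - u) * wd dx dy 1 s i := mul_pos (by linarith [hp.2]) hp0'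
  have a3 : 0 < v * wd dx dy 1 s j := mul_pos hq.1 hq0'
  have a4 : 0 < (1 - v) * wd dx dy 1 s j := mul_pos (by linarith [hq.2]) hq0'
  obtain ⟨R, hR0, hR⟩ := exists_between (lt_min (lt_min a1 a2) (lt_min a3 a4))
  simp only [lt_min_iff] at hR
  obtain ⟨⟨h1, h2⟩, h3, h4⟩ := hR
  have b1 := single_vol i s t u R ht.symm hp0' hR0 h1 h2
  have b2 := single_vol j s t v R he.symm hq0' hR0 h3 h4
  have hg : (s, t, R) ∈ Gs x0 dx y0 dy N := by
    refine ⟨hs, hR0, ?_⟩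
    have hm : MeasurableSet (Metric.closedBall t R) := Metric.isClosed_closedBall.measurableSet
    simp only [nu]
    rw [Measure.map_apply (TT_meas _ _) hm, Mw_apply _ (TT_meas _ _ hm)]
    refine le_trans ?_ (ENNReal.sum_le_tsum {i, j})
    rw [Finset.sum_pair hne, wi, wj, show 4 * R = 2 * R + 2 * R by ring,
      ENNReal.ofReal_add (by linarith) (by linarith)]
    exact add_le_add b1 b2
  have := h.le_rr s t hg
  simp only [vv, sub_self, abs_zero] at this
  linarith

open Classical in
/-- the interaction weight -/
def FF (x0 dx y0 dy : ℕ → ℝ) (N : Set ℕ) (s : ℝ) (z : (ℕ × ℝ) × (ℕ × ℝ)) : ENNReal :=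
  if 0 < rr x0 dx y0 dy N s (TT x0 dx y0 dy 1 s z.1) ∧
    |TT x0 dx y0 dy 1 s z.2 - TT x0 dx y0 dy 1 s z.1| ≤ rr x0 dx y0 dy N s (TT x0 dx y0 dy 1 s z.1)
  then ENNReal.ofReal (1 / rr x0 dx y0 dy N s (TT x0 dx y0 dy 1 s z.1)) else 0

theorem Hyp.rr_meas (h : Hyp x0 dx y0 dy N) {α : Type*} [MeasurableSpace α] {f g : α → ℝ}
    (hf : Measurable f) (hg : Measurable g) : Measurable fun a => rr x0 dx y0 dy N (f a) (g a) := by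
  have h1 := h.cont.measurable
  generalize rr x0 dx y0 dy N = F at *
  exact h1.comp (hf.prodMk hg)

theorem Hyp.FF_meas (h : Hyp x0 dx y0 dy N) :
    Measurable (fun w : ℝ × ((ℕ × ℝ) × (ℕ × ℝ)) => FF x0 dx y0 dy N w.1 w.2) := by
  have t1 : Measurable fun w : ℝ × ((ℕ × ℝ) × (ℕ × ℝ)) => TT x0 dx y0 dy 1 w.1 w.2.1 :=
    TT_meas'.comp (by fun_prop : Measurable fun w : ℝ × ((ℕ × ℝ) × (ℕ × ℝ)) => (w.1, w.2.1))
  have t2 : Measurable fun w : ℝ × ((ℕ × ℝ) × (ℕ × ℝ)) => TT x0 dx y0 dy 1 w.1 w.2.2 :=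
    TT_meas'.comp (by fun_prop : Measurable fun w : ℝ × ((ℕ × ℝ) × (ℕ × ℝ)) => (w.1, w.2.2))
  have r1 : Measurable fun w : ℝ × ((ℕ × ℝ) × (ℕ × ℝ)) =>
      rr x0 dx y0 dy N w.1 (TT x0 dx y0 dy 1 w.1 w.2.1) :=
    h.rr_meas measurable_fst t1
  unfold FF
  refine Measurable.ite ?_ ?_ measurable_const
  · exact (measurableSet_lt measurable_const r1).inter
      (measurableSet_le (continuous_abs.measurable.comp (t2.sub t1)) r1)
  · exact ENNReal.measurable_ofReal.comp (measurable_const.div r1)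

theorem Hyp.FF_meas_comp (h : Hyp x0 dx y0 dy N) {α : Type*} [MeasurableSpace α] {f : α → ℝ}
    {g : α → (ℕ × ℝ) × (ℕ × ℝ)} (hf : Measurable f) (hg : Measurable g) :
    Measurable fun a => FF x0 dx y0 dy N (f a) (g a) := by
  have h1 := h.FF_meas
  generalize FF x0 dx y0 dy N = F at *
  exact h1.comp (hf.prodMk hg)

theorem Hyp.FF_lower (h : Hyp x0 dx y0 dy N) {s0 : ℝ} (hs : s0 ∈ Icc (1/7:ℝ) 1) {p q : ℕ × ℝ}
    (hp : p.2 ∈ Ioo (0:ℝ) 1) (hq : q.2 ∈ Ioo (0:ℝ) 1)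
    (hr : 0 < rr x0 dx y0 dy N s0 (TT x0 dx y0 dy 1 s0 p))
    (he : TT x0 dx y0 dy 1 s0 p = TT x0 dx y0 dy 1 s0 q) :
    ENNReal.ofReal (1/6) ≤ ∫⁻ s in Icc (0.142:ℝ) 1, FF x0 dx y0 dy N s (p, q) := by
  set r0 := rr x0 dx y0 dy N s0 (TT x0 dx y0 dy 1 s0 p) with hr0
  have hr1 : r0 ≤ 1/20000 := h.rr_le _ _
  have hsub : Icc (s0 - 2/7 * r0) s0 ⊆ Icc (0.142:ℝ) 1 := by
    refine Icc_subset_Icc ?_ hs.2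
    have := hs.1
    linarith
  have hyp := abs_le.1 (h.hy p.1 p.2 ⟨hp.1.le, hp.2.le⟩)
  have hyq := abs_le.1 (h.hy q.1 q.2 ⟨hq.1.le, hq.2.le⟩)
  calc ENNReal.ofReal (1/6) = ∫⁻ s in Icc (s0 - 2/7 * r0) s0, ENNReal.ofReal (7 / (12 * r0)) := by
        rw [setLIntegral_const, Real.volume_Icc, ← ENNReal.ofReal_mul (by positivity)]
        congr 1; field_simp; ring
    _ ≤ ∫⁻ s in Icc (s0 - 2/7 * r0) s0, FF x0 dx y0 dy N s (p, q) := by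
        refine setLIntegral_mono' measurableSet_Icc fun s hss => ?_
        have d1 : TT x0 dx y0 dy 1 s p - TT x0 dx y0 dy 1 s0 p =
            (s - s0) * (y0 p.1 + p.2 * dy p.1) := by simp only [TT]; ring
        have d2 : TT x0 dx y0 dy 1 s q - TT x0 dx y0 dy 1 s p =
            (s - s0) * ((y0 q.1 + q.2 * dy q.1) - (y0 p.1 + p.2 * dy p.1)) := by
          simp only [TT] at he ⊢; linarith
        have ds : |s - s0| ≤ 2/7 * r0 := by
          rw [abs_le]; constructor <;> linarith [hss.1, hss.2]
        have e1 : |TT x0 dx y0 dy 1 s p - TT x0 dx y0 dy 1 s0 p| ≤ 1/7 * r0 := by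
          rw [d1, abs_mul]
          have := abs_le.2 hyp
          nlinarith [abs_nonneg (s - s0)]
        have e2 : |TT x0 dx y0 dy 1 s q - TT x0 dx y0 dy 1 s p| ≤ 2/7 * r0 := by
          rw [d2, abs_mul]
          have : |(y0 q.1 + q.2 * dy q.1) - (y0 p.1 + p.2 * dy p.1)| ≤ 1 := by
            rw [abs_le]; constructor <;> linarith [hyp.1, hyp.2, hyq.1, hyq.2]
          nlinarith [abs_nonneg (s - s0)]
        have l1 := h.lip s (TT x0 dx y0 dy 1 s p) s0 (TT x0 dx y0 dy 1 s0 p)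
        have l2 := h.lip s0 (TT x0 dx y0 dy 1 s0 p) s (TT x0 dx y0 dy 1 s p)
        rw [abs_sub_comm, abs_sub_comm s0] at l2
        set r := rr x0 dx y0 dy N s (TT x0 dx y0 dy 1 s p) with hrr
        have hrpos : 2/7 * r0 ≤ r := by linarith
        have hrle : r ≤ 12/7 * r0 := by linarith
        have hr' : 0 < r := by linarith
        have : FF x0 dx y0 dy N s (p, q) = ENNReal.ofReal (1 / r) :=
          if_pos ⟨hr', e2.trans hrpos⟩
        rw [this]
        refine ENNReal.ofReal_le_ofReal ?_
        rw [div_le_div_iff₀ (by positivity) hr']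
        linarith
    _ ≤ _ := lintegral_mono_set hsub

theorem Hyp.FF_upper (h : Hyp x0 dx y0 dy N) {s : ℝ} (hs : s ∈ Icc (0.142:ℝ) 1) {wA wB : ℕ → ℝ}
    {CA CB : ℝ} (hCA : 0 ≤ CA) (hCB : 0 ≤ CB)
    (hA : ∀ i, wA i ≤ CA * cN dx dy N s i) (hB : ∀ i, wB i ≤ CB * cN dx dy N s i) :
    ∫⁻ z, FF x0 dx y0 dy N s z ∂((Mw wA).prod (Mw wB)) ≤
      ENNReal.ofReal (CA * CB * (31.2 * om dx dy 1 s)) := by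
  have hom0 := h.om_nonneg 1 s (by norm_num)
  have mF : Measurable (FF x0 dx y0 dy N s) :=
    h.FF_meas_comp measurable_const measurable_id
  have mE : MeasurableSet {t | 0 < rr x0 dx y0 dy N s t} := by
    exact measurableSet_lt measurable_const (h.rr_meas measurable_const measurable_id)
  have mE' : MeasurableSet (TT x0 dx y0 dy 1 s ⁻¹' {t | 0 < rr x0 dx y0 dy N s t}) := TT_meas _ _ mE
  rw [lintegral_prod _ mF.aemeasurable]
  calc _ ≤ ∫⁻ p, (TT x0 dx y0 dy 1 s ⁻¹' {t | 0 < rr x0 dx y0 dy N s t}).indicator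
          (fun _ => ENNReal.ofReal (4 * CB)) p ∂(Mw wA) := by
        refine lintegral_mono fun p => ?_
        set r := rr x0 dx y0 dy N s (TT x0 dx y0 dy 1 s p) with hr
        by_cases hr0 : 0 < r
        · rw [indicator_of_mem (show p ∈ _ from hr0)]
          have mB : MeasurableSet (TT x0 dx y0 dy 1 s ⁻¹' Metric.closedBall (TT x0 dx y0 dy 1 s p) r) :=
            TT_meas _ _ Metric.isClosed_closedBall.measurableSet
          calc _ = ∫⁻ q, (TT x0 dx y0 dy 1 s ⁻¹' Metric.closedBall (TT x0 dx y0 dy 1 s p) r).indicator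
                  (fun _ => ENNReal.ofReal (1 / r)) q ∂(Mw wB) := by
                refine lintegral_congr fun q => ?_
                simp only [FF, ← hr, hr0, true_and, indicator, mem_preimage, Metric.mem_closedBall, Real.dist_eq]
            _ = ENNReal.ofReal (1/r) * Mw wB (TT x0 dx y0 dy 1 s ⁻¹' Metric.closedBall (TT x0 dx y0 dy 1 s p) r) :=
                lintegral_indicator_const mB _
            _ ≤ ENNReal.ofReal (1/r) * (ENNReal.ofReal CB * ENNReal.ofReal (4 * r)) := by
                refine mul_le_mul' le_rfl ?_
                refine (Mw_le _ _ hCB hB _).trans ?_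
                rw [Measure.smul_apply, smul_eq_mul]
                refine mul_le_mul' le_rfl ?_
                have := h.max_rr hs (TT x0 dx y0 dy 1 s p)
                unfold nu at this
                rwa [Measure.map_apply (TT_meas _ _) Metric.isClosed_closedBall.measurableSet] at this
            _ = _ := by
                rw [← ENNReal.ofReal_mul hCB, ← ENNReal.ofReal_mul (by positivity)]
                congr 1; field_simp
        · have : ∀ q, FF x0 dx y0 dy N s (p, q) = 0 := fun q => if_neg fun hh => hr0 hh.1
          simp [this]
    _ = ENNReal.ofReal (4 * CB) * Mw wA (TT x0 dx y0 dy 1 s ⁻¹' {t | 0 < rr x0 dx y0 dy N s t}) :=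
        lintegral_indicator_const mE' _
    _ ≤ ENNReal.ofReal (4 * CB) * (ENNReal.ofReal CA * ENNReal.ofReal (7.8 * om dx dy 1 s)) := by
        refine mul_le_mul' le_rfl ?_
        refine (Mw_le _ _ hCA hA _).trans ?_
        rw [Measure.smul_apply, smul_eq_mul]
        refine mul_le_mul' le_rfl ?_
        have := h.vitali hs
        unfold nu at this
        rwa [Measure.map_apply (TT_meas _ _) mE] at this
    _ = _ := by
        rw [← ENNReal.ofReal_mul hCA, ← ENNReal.ofReal_mul (by positivity)]
        congr 1; ring

/-- pairs of points crossing at a slope in `[1/7,1]` -/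
def SS (x0 dx y0 dy wA wB : ℕ → ℝ) : Set ((ℕ × ℝ) × (ℕ × ℝ)) :=
  {z | z.1.2 ∈ Ioo (0:ℝ) 1 ∧ z.2.2 ∈ Ioo (0:ℝ) 1 ∧ 0 < wA z.1.1 ∧ 0 < wB z.2.1 ∧
    ∃ s ∈ Icc (1/7:ℝ) 1, TT x0 dx y0 dy 1 s z.1 = TT x0 dx y0 dy 1 s z.2}

theorem Hyp.core (h : Hyp x0 dx y0 dy N) {wA wB : ℕ → ℝ}
    {CA CB : ℝ} (hCA : 0 ≤ CA) (hCB : 0 ≤ CB)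
    (hA : ∀ s ∈ Icc (0.142:ℝ) 1, ∀ i, wA i ≤ CA * cN dx dy N s i)
    (hB : ∀ s ∈ Icc (0.142:ℝ) 1, ∀ i, wB i ≤ CB * cN dx dy N s i)
    (hd : ∀ i, 0 < wA i → ¬ 0 < wB i) :
    ENNReal.ofReal (1/6) * (Mw wA).prod (Mw wB) (SS x0 dx y0 dy wA wB) ≤
      ∫⁻ s in Icc (0.142:ℝ) 1, ENNReal.ofReal (CA * CB * (31.2 * om dx dy 1 s)) := by
  have hsub : SS x0 dx y0 dy wA wB ⊆
      {z | ENNReal.ofReal (1/6) ≤ ∫⁻ s in Icc (0.142:ℝ) 1, FF x0 dx y0 dy N s z} := by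
    rintro ⟨p, q⟩ ⟨hp, hq, hp0, hq0, s, hs, he⟩
    simp only at hp hq hp0 hq0 he
    have hs' : s ∈ Icc (0.142:ℝ) 1 := ⟨by linarith [hs.1], hs.2⟩
    have c1 : 0 < cN dx dy N s p.1 := by
      by_contra hc; push Not at hc
      nlinarith [hA s hs' p.1]
    have c2 : 0 < cN dx dy N s q.1 := by
      by_contra hc; push Not at hc
      nlinarith [hB s hs' q.1]
    have hne : p.1 ≠ q.1 := fun e => hd p.1 hp0 (e ▸ hq0)
    exact h.FF_lower hs hp hq (h.pos hs' hp hq hne c1 c2 he) he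
  have mF : Measurable fun w : ((ℕ × ℝ) × (ℕ × ℝ)) × ℝ => FF x0 dx y0 dy N w.2 w.1 :=
    h.FF_meas_comp measurable_snd measurable_fst
  calc _ ≤ ENNReal.ofReal (1/6) * (Mw wA).prod (Mw wB)
        {z | ENNReal.ofReal (1/6) ≤ ∫⁻ s in Icc (0.142:ℝ) 1, FF x0 dx y0 dy N s z} :=
        mul_le_mul' le_rfl (measure_mono hsub)
    _ ≤ ∫⁻ z, ∫⁻ s in Icc (0.142:ℝ) 1, FF x0 dx y0 dy N s z ∂volume ∂((Mw wA).prod (Mw wB)) :=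
        mul_meas_ge_le_lintegral mF.lintegral_prod_right' _
    _ = ∫⁻ s in Icc (0.142:ℝ) 1, ∫⁻ z, FF x0 dx y0 dy N s z ∂((Mw wA).prod (Mw wB)) := by
        rw [lintegral_lintegral_swap]
        exact mF.aemeasurable
    _ ≤ _ := by
        refine setLIntegral_mono' measurableSet_Icc fun s hs => ?_
        exact h.FF_upper hs hCA hCB (hA s hs) (hB s hs)

end

section

variable {x0 dx y0 dy : ℕ → ℝ} {N : Set ℕ}

/-- nice segments -/
def NN (dx dy : ℕ → ℝ) : Set ℕ := {i | 30 * |dy i| ≤ |dx i| ∨ 30 * |dx i| ≤ |dy i|}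

theorem wd_H {s : ℝ} (hs : s ∈ Icc (0.142:ℝ) 1) (i : ℕ) : |dx i| - |dy i| ≤ wd dx dy 1 s i := by
  unfold wd
  have h1 := abs_sub_abs_le_abs_sub (1 * dx i) (-(s * dy i))
  rw [abs_neg, abs_mul, abs_mul, sub_neg_eq_add, abs_one, one_mul, abs_of_nonneg (by linarith [hs.1] : 0 ≤ s)] at h1
  nlinarith [hs.2, abs_nonneg (dy i)]

theorem wd_V {s : ℝ} (hs : s ∈ Icc (0.142:ℝ) 1) (i : ℕ) :
    0.142 * |dy i| - |dx i| ≤ wd dx dy 1 s i := by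
  unfold wd
  have h1 := abs_sub_abs_le_abs_sub (s * dy i) (-(dx i))
  rw [abs_neg, abs_mul, sub_neg_eq_add, abs_of_nonneg (by linarith [hs.1] : 0 ≤ s), add_comm] at h1
  rw [one_mul]
  nlinarith [hs.1, abs_nonneg (dy i)]

theorem cN_H {s : ℝ} (hs : s ∈ Icc (0.142:ℝ) 1) (i : ℕ) :
    wH dx dy i ≤ 1.035 * cN dx dy (NN dx dy) s i := by
  have hn : 0 ≤ cN dx dy (NN dx dy) s i := indicator_nonneg (fun _ _ => wd_nonneg _ _ _) i
  unfold wH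
  split_ifs with hh
  · have : i ∈ NN dx dy := Or.inl hh
    unfold cN
    rw [indicator_of_mem this]
    have := wd_H (dx := dx) (dy := dy) hs i
    linarith [abs_nonneg (dy i), abs_nonneg (dx i)]
  · positivity

theorem cN_V {s : ℝ} (hs : s ∈ Icc (0.142:ℝ) 1) (i : ℕ) :
    wH dy dx i ≤ 9.21 * cN dx dy (NN dx dy) s i := by
  have hn : 0 ≤ cN dx dy (NN dx dy) s i := indicator_nonneg (fun _ _ => wd_nonneg _ _ _) i
  unfold wH
  split_ifs with hh
  · have : i ∈ NN dx dy := Or.inr hh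
    unfold cN
    rw [indicator_of_mem this]
    have := wd_V (dx := dx) (dy := dy) hs i
    linarith [abs_nonneg (dy i), abs_nonneg (dx i)]
  · positivity

theorem BD.hyp (h : BD x0 dx y0 dy) : Hyp x0 dx y0 dy (NN dx dy) where
  toBD := h
  hom := fun s hs => by
    have := h.om_le hs.1 hs.2
    have := h.om_nonneg 1 (-s) (by norm_num)
    linarith
  hN := fun i hi s hs => by
    have h1 := wd_V (dx := dx) (dy := dy) hs i
    have h2 := wd_H (dx := dx) (dy := dy) hs i
    rcases hi with hi | hi <;> linarith [abs_nonneg (dy i), abs_nonneg (dx i)]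

theorem wH_disj (i : ℕ) (h1 : 0 < wH dx dy i) : ¬ 0 < wH dy dx i := by
  unfold wH at *
  intro h2
  split_ifs at h1 h2 with a b <;> linarith

theorem BD.two (h : BD x0 dx y0 dy) {wA wB : ℕ → ℝ} {CA CB : ℝ} (hCA : 0 ≤ CA) (hCB : 0 ≤ CB)
    (hC : CA * CB ≤ 9.6)
    (hA : ∀ s ∈ Icc (0.142:ℝ) 1, ∀ i, wA i ≤ CA * cN dx dy (NN dx dy) s i)
    (hB : ∀ s ∈ Icc (0.142:ℝ) 1, ∀ i, wB i ≤ CB * cN dx dy (NN dx dy) s i)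
    (hA' : ∀ s ∈ Icc (0.142:ℝ) 1, ∀ i, wA i ≤ CA * cN (fun i => -dx i) dy (NN (fun i => - dx i) dy) s i)
    (hB' : ∀ s ∈ Icc (0.142:ℝ) 1, ∀ i, wB i ≤ CB * cN (fun i => -dx i) dy (NN (fun i => - dx i) dy) s i)
    (hd : ∀ i, 0 < wA i → ¬ 0 < wB i) :
    (Mw wA).prod (Mw wB) (SS x0 dx y0 dy wA wB) +
    (Mw wA).prod (Mw wB) (SS (fun i => - x0 i) (fun i => -dx i) y0 dy wA wB) ≤ ENNReal.ofReal 0.125 := by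
  have c1 := h.hyp.core hCA hCB hA hB hd
  have c2 := h.refl.hyp.core hCA hCB hA' hB' hd
  have e : ∀ s, om (fun i => -dx i) dy 1 s = om dx dy 1 (-s) := by
    intro s
    unfold om wd
    rw [abs_neg]
    congr 2; ext i
    rw [← abs_neg]; congr 1; ring
  have key : ENNReal.ofReal (1/6) * ((Mw wA).prod (Mw wB) (SS x0 dx y0 dy wA wB) +
    (Mw wA).prod (Mw wB) (SS (fun i => - x0 i) (fun i => -dx i) y0 dy wA wB)) ≤
      ENNReal.ofReal (1/6) * ENNReal.ofReal 0.125 := by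
    rw [mul_add]
    refine (add_le_add c1 c2).trans ?_
    refine (le_lintegral_add _ _).trans ?_
    calc _ ≤ ∫⁻ s in Icc (0.142:ℝ) 1, ENNReal.ofReal (9.6 * 31.2 * (8/100000)) := by
          refine setLIntegral_mono' measurableSet_Icc fun s hs => ?_
          have o1 := h.om_nonneg 1 s (by norm_num)
          have o2 := h.om_nonneg 1 (-s) (by norm_num)
          have o3 := h.om_le hs.1 hs.2
          have hCC : 0 ≤ CA * CB := mul_nonneg hCA hCB
          rw [e, ← ENNReal.ofReal_add (by positivity) (by positivity)]
          refine ENNReal.ofReal_le_ofReal ?_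
          calc _ = (CA * CB) * (31.2 * (om dx dy 1 s + om dx dy 1 (-s))) := by ring
            _ ≤ 9.6 * (31.2 * (8/100000)) := by gcongr
            _ = _ := by ring
      _ ≤ _ := by
          rw [setLIntegral_const, Real.volume_Icc, ← ENNReal.ofReal_mul (by positivity),
            ← ENNReal.ofReal_mul (by positivity)]
          refine ENNReal.ofReal_le_ofReal ?_
          norm_num
  exact (ENNReal.mul_le_mul_iff_right (by simp) ENNReal.ofReal_ne_top).1 key

theorem Mw_null (c : ℕ → ℝ) : Mw c {p | ¬ (p.2 ∈ Ioo (0:ℝ) 1 ∧ 0 < c p.1)} = 0 := by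
  have m : MeasurableSet {p : ℕ × ℝ | ¬ (p.2 ∈ Ioo (0:ℝ) 1 ∧ 0 < c p.1)} := by
    have := meas_nat c
    refine MeasurableSet.compl (MeasurableSet.inter ?_ ?_)
    · exact measurable_snd measurableSet_Ioo
    · exact measurableSet_lt measurable_const (this.comp measurable_fst)
  rw [Mw_apply c m, ENNReal.tsum_eq_zero]
  intro i
  by_cases hc : 0 < c i
  · have : {u | (i, u) ∈ {p : ℕ × ℝ | ¬ (p.2 ∈ Ioo (0:ℝ) 1 ∧ 0 < c p.1)}} ∩ Ioo (0:ℝ) 1 = ∅ := by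
      refine eq_empty_of_forall_notMem ?_
      rintro u ⟨h1, h2⟩
      have h1' : ¬ (u ∈ Ioo (0:ℝ) 1 ∧ 0 < c i) := h1
      exact h1' ⟨h2, hc⟩
    rw [this]; simp
  · rw [ENNReal.ofReal_of_nonpos (by linarith)]; simp

theorem BD.strip (h : BD x0 dx y0 dy) (t : ℝ) :
    Mw (wH dx dy) {p | |TT x0 dx y0 dy 1 0 p - t| < 1/7} ≤ ENNReal.ofReal (2/7 + 0.0065) := by
  have := h.F1 1 0 (by norm_num) (c := wH dx dy) wH_le (E := Metric.ball t (1/7)) measurableSet_ball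
  refine le_trans (le_of_eq ?_) (this.trans ?_)
  · rfl
  · rw [Real.volume_ball, ← ENNReal.ofReal_add (by norm_num) (h.om_nonneg 1 0 (by norm_num))]
    refine ENNReal.ofReal_le_ofReal ?_
    linarith [h.proj_le]

theorem cross {a c d : ℝ} (h : |c| ≤ |d|) (hc : 1/7 ≤ |c|) (hd : |d| ≤ 1) (e : a = c / d) :
    |a| ∈ Icc (1/7:ℝ) 1 := by
  have hd0 : 0 < |d| := by linarith
  rw [e, abs_div]
  constructor
  · rw [le_div_iff₀ hd0]; nlinarith
  · rw [div_le_one hd0]; exact h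

theorem BD.cross1 {wA wB : ℕ → ℝ} (z : (ℕ × ℝ) × (ℕ × ℝ))
    (h1 : z.1.2 ∈ Ioo (0:ℝ) 1) (h2 : z.2.2 ∈ Ioo (0:ℝ) 1) (h3 : 0 < wA z.1.1) (h4 : 0 < wB z.2.1)
    (hle : |TT x0 dx y0 dy 1 0 z.1 - TT x0 dx y0 dy 1 0 z.2| ≤
      |TT y0 dy x0 dx 1 0 z.2 - TT y0 dy x0 dx 1 0 z.1|)
    (hc : 1/7 ≤ |TT x0 dx y0 dy 1 0 z.1 - TT x0 dx y0 dy 1 0 z.2|)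
    (hd : |TT y0 dy x0 dx 1 0 z.2 - TT y0 dy x0 dx 1 0 z.1| ≤ 1) :
    z ∈ SS x0 dx y0 dy wA wB ∨ z ∈ SS (fun i => -x0 i) (fun i => -dx i) y0 dy wA wB := by
  set c := TT x0 dx y0 dy 1 0 z.1 - TT x0 dx y0 dy 1 0 z.2 with hcdef
  set d := TT y0 dy x0 dx 1 0 z.2 - TT y0 dy x0 dx 1 0 z.1 with hddef
  have hd0 : d ≠ 0 := by
    intro h0; rw [h0, abs_zero] at hle; linarith
  have hs := cross hle hc hd rfl
  have hm : c / d * d = c := div_mul_cancel₀ _ hd0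
  set s := c / d with hsdef
  simp only [TT] at hcdef hddef
  rcases le_total 0 s with h0 | h0
  · left
    rw [abs_of_nonneg h0] at hs
    refine ⟨h1, h2, h3, h4, s, hs, ?_⟩
    simp only [TT]
    have : c = s * d := by linarith
    rw [hcdef, hddef] at this
    linarith
  · right
    rw [abs_of_nonpos h0] at hs
    refine ⟨h1, h2, h3, h4, -s, hs, ?_⟩
    simp only [TT]
    have : c = s * d := by linarith
    rw [hcdef, hddef] at this
    linarith

theorem TT_fst (p : ℕ × ℝ) : TT x0 dx y0 dy 1 0 p = x0 p.1 + p.2 * dx p.1 := by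
  simp [TT]

theorem wH_neg1 : wH (fun i => -dx i) dy = wH dx dy := by
  ext i; simp [wH]

theorem wH_neg2 : wH dx (fun i => -dy i) = wH dx dy := by
  ext i; simp [wH]

theorem strip_prod {α β : Type*} [MeasurableSpace α] [MeasurableSpace β] (μ : Measure α) (ν : Measure β)
    [SFinite μ] [SFinite ν] {f : α → ℝ} {g : β → ℝ} (hf : Measurable f) (hg : Measurable g) {C : ENNReal}
    (hC : ∀ t, μ {p | |f p - t| < 1/7} ≤ C) :
    μ.prod ν {z | |f z.1 - g z.2| < 1/7} ≤ C * ν univ := by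
  have mX : MeasurableSet {z : α × β | |f z.1 - g z.2| < 1/7} :=
    measurableSet_lt (continuous_abs.measurable.comp
      ((hf.comp measurable_fst).sub (hg.comp measurable_snd))) measurable_const
  rw [Measure.prod_apply_symm mX, ← lintegral_const]
  exact lintegral_mono fun q => hC (g q)

theorem strip_prod' {α β : Type*} [MeasurableSpace α] [MeasurableSpace β] (μ : Measure α) (ν : Measure β)
    [SFinite μ] [SFinite ν] {f : β → ℝ} {g : α → ℝ} (hf : Measurable f) (hg : Measurable g) {C : ENNReal}
    (hC : ∀ t, ν {p | |f p - t| < 1/7} ≤ C) :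
    μ.prod ν {z | |f z.2 - g z.1| < 1/7} ≤ C * μ univ := by
  have mX : MeasurableSet {z : α × β | |f z.2 - g z.1| < 1/7} :=
    measurableSet_lt (continuous_abs.measurable.comp
      ((hf.comp measurable_snd).sub (hg.comp measurable_fst))) measurable_const
  rw [Measure.prod_apply mX, ← lintegral_const]
  exact lintegral_mono fun q => hC (g q)

theorem BD.false (h : BD x0 dx y0 dy) : False := by
  set wA := wH dx dy with hwA
  set wB := wH dy dx with hwB
  set μ := (Mw wA).prod (Mw wB) with hμ
  have t1 := h.two (wA := wA) (wB := wB) (CA := 1.035) (CB := 9.21) (by norm_num) (by norm_num) (by norm_num)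
    (fun s hs => cN_H hs) (fun s hs => cN_V hs)
    (fun s hs i => by
      have := cN_H (dx := fun i => -dx i) (dy := dy) hs i
      rwa [wH_neg1] at this)
    (fun s hs i => by
      have := cN_V (dx := fun i => -dx i) (dy := dy) hs i
      rwa [wH_neg2] at this) wH_disj
  have t2 := h.swap.two (wA := wA) (wB := wB) (CA := 9.21) (CB := 1.035) (by norm_num) (by norm_num) (by norm_num)
    (fun s hs => cN_V hs) (fun s hs => cN_H hs)
    (fun s hs i => by
      have := cN_V (dx := fun i => -dy i) (dy := dx) hs i
      rwa [wH_neg2] at this)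
    (fun s hs i => by
      have := cN_H (dx := fun i => -dy i) (dy := dx) hs i
      rwa [wH_neg1] at this) wH_disj
  rw [← hμ] at t1 t2
  have ua : Mw wA univ = ENNReal.ofReal (∑' i, wA i) := Mw_univ wH_nonneg h.wH_sum
  have ub : Mw wB univ = ENNReal.ofReal (∑' i, wB i) := Mw_univ wH_nonneg h.swap.wH_sum
  have ha := h.wH_ge
  have hb := h.swap.wH_ge
  rw [← hwA] at ha
  rw [← hwB] at hb
  set a := ∑' i, wA i with hadef
  set b := ∑' i, wB i with hbdef
  set X : Set ((ℕ × ℝ) × (ℕ × ℝ)) := {z | |TT x0 dx y0 dy 1 0 z.1 - TT x0 dx y0 dy 1 0 z.2| < 1/7} with hX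
  set Y : Set ((ℕ × ℝ) × (ℕ × ℝ)) := {z | |TT y0 dy x0 dx 1 0 z.2 - TT y0 dy x0 dx 1 0 z.1| < 1/7} with hY
  have bX : μ X ≤ ENNReal.ofReal (2/7 + 0.0065) * ENNReal.ofReal b := by
    rw [← ub]
    exact strip_prod (Mw wA) (Mw wB) (TT_meas 1 0) (TT_meas 1 0) h.strip
  have bY : μ Y ≤ ENNReal.ofReal (2/7 + 0.0065) * ENNReal.ofReal a := by
    rw [← ua]
    exact strip_prod' (Mw wA) (Mw wB) (TT_meas 1 0) (TT_meas 1 0) h.swap.strip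
  set ZA : Set (ℕ × ℝ) := {p | ¬ (p.2 ∈ Ioo (0:ℝ) 1 ∧ 0 < wA p.1)} with hZA
  set ZB : Set (ℕ × ℝ) := {p | ¬ (p.2 ∈ Ioo (0:ℝ) 1 ∧ 0 < wB p.1)} with hZB
  have n1 : μ (ZA ×ˢ univ) = 0 := by
    rw [hμ, Measure.prod_prod, hZA, Mw_null, zero_mul]
  have n2 : μ (univ ×ˢ ZB) = 0 := by
    rw [hμ, Measure.prod_prod, hZB, Mw_null, mul_zero]
  have hcov : (univ : Set ((ℕ × ℝ) × (ℕ × ℝ))) ⊆ ((ZA ×ˢ univ) ∪ (univ ×ˢ ZB)) ∪ (X ∪ Y) ∪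
      ((SS x0 dx y0 dy wA wB ∪ SS (fun i => -x0 i) (fun i => -dx i) y0 dy wA wB) ∪
      (SS y0 dy x0 dx wA wB ∪ SS (fun i => -y0 i) (fun i => -dy i) x0 dx wA wB)) := by
    intro z _
    by_cases hz1 : z.1.2 ∈ Ioo (0:ℝ) 1 ∧ 0 < wA z.1.1
    swap
    · exact Or.inl (Or.inl (Or.inl ⟨hz1, mem_univ _⟩))
    by_cases hz2 : z.2.2 ∈ Ioo (0:ℝ) 1 ∧ 0 < wB z.2.1
    swap
    · exact Or.inl (Or.inl (Or.inr ⟨mem_univ _, hz2⟩))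
    by_cases hzX : z ∈ X
    · exact Or.inl (Or.inr (Or.inl hzX))
    by_cases hzY : z ∈ Y
    · exact Or.inl (Or.inr (Or.inr hzY))
    right
    have gX : 1/7 ≤ |TT x0 dx y0 dy 1 0 z.1 - TT x0 dx y0 dy 1 0 z.2| := not_lt.1 hzX
    have gY : 1/7 ≤ |TT y0 dy x0 dx 1 0 z.2 - TT y0 dy x0 dx 1 0 z.1| := not_lt.1 hzY
    have lX : |TT x0 dx y0 dy 1 0 z.1 - TT x0 dx y0 dy 1 0 z.2| ≤ 1 := by
      rw [TT_fst, TT_fst]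
      have a1 := abs_le.1 (h.hx z.1.1 z.1.2 ⟨hz1.1.1.le, hz1.1.2.le⟩)
      have a2 := abs_le.1 (h.hx z.2.1 z.2.2 ⟨hz2.1.1.le, hz2.1.2.le⟩)
      rw [abs_le]; constructor <;> linarith [a1.1, a1.2, a2.1, a2.2]
    have lY : |TT y0 dy x0 dx 1 0 z.2 - TT y0 dy x0 dx 1 0 z.1| ≤ 1 := by
      rw [TT_fst, TT_fst]
      have a1 := abs_le.1 (h.hy z.1.1 z.1.2 ⟨hz1.1.1.le, hz1.1.2.le⟩)
      have a2 := abs_le.1 (h.hy z.2.1 z.2.2 ⟨hz2.1.1.le, hz2.1.2.le⟩)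
      rw [abs_le]; constructor <;> linarith [a1.1, a1.2, a2.1, a2.2]
    rcases le_total |TT x0 dx y0 dy 1 0 z.1 - TT x0 dx y0 dy 1 0 z.2|
      |TT y0 dy x0 dx 1 0 z.2 - TT y0 dy x0 dx 1 0 z.1| with hle | hle
    · left
      exact BD.cross1 z hz1.1 hz2.1 hz1.2 hz2.2 hle gX lY
    · right
      rw [abs_sub_comm] at hle gY
      rw [abs_sub_comm (TT x0 dx y0 dy 1 0 z.1)] at hle lX
      exact BD.cross1 z hz1.1 hz2.1 hz1.2 hz2.2 hle gY lX
  have htot : ENNReal.ofReal a * ENNReal.ofReal b ≤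
      ((0 + 0) + (ENNReal.ofReal (2/7 + 0.0065) * ENNReal.ofReal b +
        ENNReal.ofReal (2/7 + 0.0065) * ENNReal.ofReal a)) +
      (ENNReal.ofReal 0.125 + ENNReal.ofReal 0.125) := by
    calc _ = μ univ := by rw [hμ, ← univ_prod_univ, Measure.prod_prod, ua, ub]
      _ ≤ _ := measure_mono hcov
      _ ≤ _ := measure_union_le _ _
      _ ≤ _ := by
        refine add_le_add ((measure_union_le _ _).trans (add_le_add ((measure_union_le _ _).trans ?_)
          ((measure_union_le _ _).trans (add_le_add bX bY))))
          ((measure_union_le _ _).trans (add_le_add ((measure_union_le _ _).trans t1)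
            ((measure_union_le _ _).trans t2)))
        rw [n1, n2]
  have ha0 : 0 ≤ a := by linarith
  have hb0 : 0 ≤ b := by linarith
  rw [add_zero, zero_add, ← ENNReal.ofReal_mul ha0, ← ENNReal.ofReal_mul (by norm_num),
    ← ENNReal.ofReal_mul (by norm_num), ← ENNReal.ofReal_add (by positivity) (by positivity),
    ← ENNReal.ofReal_add (by positivity) (by positivity),
    ← ENNReal.ofReal_add (by positivity) (by positivity),
    ENNReal.ofReal_le_ofReal_iff (by positivity)] at htot
  nlinarith

end

end Helpers

/-- any interior segment barrier for the unit square
has total length at least 2 + 10⁻⁵. -/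
theorem interior_barrier_length_lower_bound
    (a b : ℕ → Pt) (hab : ∀ i, a i ≠ b i)
    (hbar : IsBarrier (⋃ i, segment ℝ (a i) (b i)) unitSquare)
    (hint : (⋃ i, segment ℝ (a i) (b i)) ⊆ unitSquare)
    (hsum : Summable fun i => ‖b i - a i‖) :
    2 + 10 ^ (-5 : ℤ) ≤ ∑' i, ‖b i - a i‖ := by
  by_contra hcon
  push Not at hcon
  have hnorm : (fun i => ‖b i - a i‖) = fun i => √((b i 0 - a i 0) ^ 2 + (b i 1 - a i 1) ^ 2) := by
    ext i
    rw [EuclideanSpace.norm_eq, Fin.sum_univ_two]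
    simp
  have hmem : ∀ i, ∀ u ∈ Icc (0:ℝ) 1,
      a i 0 + u * (b i 0 - a i 0) ∈ Icc (0:ℝ) 1 ∧ a i 1 + u * (b i 1 - a i 1) ∈ Icc (0:ℝ) 1 := by
    intro i u hu
    have h1 : (1 - u) • a i + u • b i ∈ unitSquare := hint (mem_iUnion.2 ⟨i, 1 - u, u,
      by linarith [hu.2], hu.1, by ring, rfl⟩)
    obtain ⟨h2, h3⟩ := h1
    simp only [PiLp.add_apply, PiLp.smul_apply, smul_eq_mul] at h2 h3
    constructor
    · convert h2 using 1; ring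
    · convert h3 using 1; ring
  have hBD : BD (fun i => a i 0 - 1/2) (fun i => b i 0 - a i 0) (fun i => a i 1 - 1/2)
      (fun i => b i 1 - a i 1) := by
    refine ⟨?_, ?_, ?_, ?_, ?_, ?_⟩
    · intro i u hu
      obtain ⟨⟨h1, h2⟩, -⟩ := hmem i u hu
      simp only
      rw [abs_le]; constructor <;> linarith
    · intro i u hu
      obtain ⟨-, ⟨h1, h2⟩⟩ := hmem i u hu
      simp only
      rw [abs_le]; constructor <;> linarith
    · intro A B t hAB ht
      have hD : 0 < |A| + |B| := by
        rcases hAB with h | h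
        · have := abs_pos.2 h; positivity
        · have := abs_pos.2 h; positivity
      obtain ⟨k, hk, hkt⟩ : ∃ k : ℝ, |k| ≤ 1/2 ∧ k * (|A| + |B|) = t := by
        refine ⟨t / (|A| + |B|), ?_, div_mul_cancel₀ _ hD.ne'⟩
        rw [abs_div, abs_of_pos hD, div_le_iff₀ hD]; linarith
      have hsg : ∀ x : ℝ, ∃ e : ℝ, |e| ≤ 1 ∧ x * e = |x| := by
        intro x
        rcases le_total 0 x with hx | hx
        · exact ⟨1, by simp, by rw [abs_of_nonneg hx]; ring⟩
        · exact ⟨-1, by simp, by rw [abs_of_nonpos hx]; ring⟩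
      obtain ⟨e, he, heA⟩ := hsg A
      obtain ⟨f, hf, hfB⟩ := hsg B
      have b1 : |k * e| ≤ 1/2 := by
        rw [abs_mul]; nlinarith [abs_nonneg k, abs_nonneg e]
      have b2 : |k * f| ≤ 1/2 := by
        rw [abs_mul]; nlinarith [abs_nonneg k, abs_nonneg f]
      rw [abs_le] at b1 b2
      let P : Pt := !₂[1/2 + k * e, 1/2 + k * f]
      let v : Pt := !₂[-B, A]
      have hv : v ≠ 0 := by
        intro h0
        have h1 : v 0 = 0 := by rw [h0]; rfl
        have h2 : v 1 = 0 := by rw [h0]; rfl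
        simp [v] at h1 h2
        rcases hAB with h | h
        · exact h h2
        · exact h h1
      obtain ⟨q, ⟨τ, hq⟩, hqΓ⟩ := hbar {q : Pt | ∃ t : ℝ, q = P + t • v} ⟨P, v, hv, rfl⟩
        ⟨P, ⟨0, by simp⟩, by
          constructor
          · simp [P]; constructor <;> linarith
          · simp [P]; constructor <;> linarith⟩
      obtain ⟨i, w, u, hw, hu, hwu, rfl⟩ := mem_iUnion.1 hqΓ
      have q0 := congrArg (fun x : Pt => x 0) hq
      have q1 := congrArg (fun x : Pt => x 1) hq
      simp [P, v] at q0 q1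
      refine ⟨i, u, ⟨hu, by linarith⟩, ?_⟩
      have hw' : w = 1 - u := by linarith
      subst hw'
      simp only
      rw [← hkt, ← heA, ← hfB]
      linear_combination A * q0 + B * q1
    · intro i
      by_contra hc
      push Not at hc
      obtain ⟨h1, h2⟩ := hc
      refine hab i ?_
      ext j
      fin_cases j
      · simp at h1 ⊢; linarith
      · simp at h2 ⊢; linarith
    · rw [hnorm] at hsum; exact hsum
    · rw [hnorm] at hcon
      refine hcon.le.trans ?_
      norm_num
  exact hBD.false
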